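/- arXiv:1506.03362 — 3 statements merged into one kernel-verified Lean document; each statement's English description precedes it below -/
import Mathlib

section
/- For every t ∈ ℝ and every a ∈ ℓ²(ℤ), ‖T_t a‖_{ℓ²} = ‖a‖_{ℓ²}; i.e., T_t is an isometry of ℓ²(ℤ). -/
/-- The ℓ²-type norm of a sequence: `√(∑ |f m|²)`. -/
noncomputable def l2norm (f : ℤ → ℂ) : ℝ := Real.sqrt (∑' m : ℤ, ‖f m‖ ^ 2)

open scoped Classical in
/-- The family `(T_t)`: for integer `t`, `(T_t a)_m = (−1)^t·a_{m+t}`; for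
non-integer `t`, `(T_t a)_m = (sin(πt)/π)·∑_{n∈ℤ} a_n/(m−n+t)`. -/
noncomputable def Tgrp (t : ℝ) (a : ℤ → ℂ) (m : ℤ) : ℂ :=
  if t = (⌊t⌋ : ℝ) then ((-1 : ℂ) ^ ⌊t⌋) * a (m + ⌊t⌋)
  else ((Real.sin (Real.pi * t) / Real.pi : ℝ) : ℂ) *
    ∑' n : ℤ, a n / ((m : ℂ) - (n : ℂ) + (t : ℂ))

open MeasureTheory AddCircle Complex in
theorem aux_coeff (t : ℝ) (ht : ∀ k : ℤ, (k : ℝ) + t ≠ 0) (k : ℤ) :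
    fourierCoeff (T := (1:ℝ)) (AddCircle.liftIoc 1 0
      (fun x : ℝ => exp (Real.pi * t * I) * exp ((-2 * Real.pi * t * I) * x))) k =
    ((Real.sin (Real.pi * t) / Real.pi : ℝ) : ℂ) / ((k : ℂ) + t) := by
  have hk : (k : ℂ) + t ≠ 0 := by exact_mod_cast ht k
  have hpi : (Real.pi : ℂ) ≠ 0 := by exact_mod_cast Real.pi_ne_zero
  have hc : (-2 * Real.pi * (k + t) * I : ℂ) ≠ 0 := by
    simp [hk, hpi]
  rw [fourierCoeff_eq_intervalIntegral _ _ 0]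
  have h1 : ∫ x in (0:ℝ)..0 + 1, (fourier (T := (1:ℝ)) (-k) (x : AddCircle (1:ℝ))) •
      (AddCircle.liftIoc 1 0
      (fun x : ℝ => exp (Real.pi * t * I) * exp ((-2 * Real.pi * t * I) * x))) (x : AddCircle (1:ℝ))
      = ∫ x in (0:ℝ)..0 + 1, exp (Real.pi * t * I) * exp ((-2 * Real.pi * (k + t) * I) * x) := by
    refine intervalIntegral.integral_congr_ae (ae_of_all _ fun x hx => ?_)
    rw [Set.uIoc_of_le (by norm_num)] at hx
    rw [liftIoc_coe_apply hx, fourier_coe_apply, smul_eq_mul, mul_left_comm, ← Complex.exp_add]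
    congr 2
    push_cast
    ring
  rw [h1, intervalIntegral.integral_const_mul, integral_exp_mul_complex hc]
  have h2 : exp (-2 * Real.pi * (k + t) * I) = exp (-(Real.pi * t * I)) * exp (-(Real.pi * t * I)) := by
    rw [← Complex.exp_add, Complex.exp_eq_exp_iff_exists_int]
    exact ⟨-k, by push_cast; ring⟩
  have h3 : exp (Real.pi * t * I) * exp (-(Real.pi * t * I)) = 1 := by
    rw [← Complex.exp_add]; simp
  simp only [zero_add, ofReal_one, mul_one, ofReal_zero, mul_zero, Complex.exp_zero, h2]
  push_cast
  rw [Complex.sin, ← neg_mul] at *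
  simp only [neg_mul] at *
  rw [div_one, one_smul, ← mul_div_assoc]
  have : exp (Real.pi * t * I) * (exp (-(Real.pi * t * I)) * exp (-(Real.pi * t * I)) - 1) =
      exp (-(Real.pi * t * I)) - exp (Real.pi * t * I) := by
    linear_combination exp (-(Real.pi * t * I)) * h3
  rw [this]
  have hI := Complex.I_ne_zero
  rw [div_div, div_eq_div_iff (by simpa using hc) (by simp [hk, hpi])]
  linear_combination ((exp (-(Real.pi * t * I)) - exp (Real.pi * t * I)) * Real.pi * (k + t)) * Complex.I_sq

open MeasureTheory AddCircle Complex in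
theorem aux_main (t : ℝ) (ht : ∀ k : ℤ, (k : ℝ) + t ≠ 0) (a : ℤ → ℂ) (ha : Memℓp a 2) :
    ∑' m : ℤ, ‖((Real.sin (Real.pi * t) / Real.pi : ℝ) : ℂ) *
      ∑' n : ℤ, a n / ((m : ℂ) - (n : ℂ) + (t : ℂ))‖ ^ 2 = ∑' m : ℤ, ‖a m‖ ^ 2 := by
  set g0 : ℝ → ℂ := fun x : ℝ => exp (Real.pi * t * I) * exp ((-2 * Real.pi * t * I) * x) with hg0
  set g : AddCircle (1:ℝ) → ℂ := AddCircle.liftIoc 1 0 g0 with hg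
  have hg0n : ∀ x, ‖g0 x‖ = 1 := by
    intro x
    simp only [hg0, norm_mul, Complex.norm_exp]
    simp
  have hgn : ∀ x, ‖g x‖ = 1 := fun x => hg0n _
  have hgm : AEStronglyMeasurable g (haarAddCircle (T := (1:ℝ))) := by
    have h : MemLp g0 2 (volume.restrict (Set.Ioc (0:ℝ) (0 + 1))) := by
      refine MemLp.of_bound (Continuous.aestronglyMeasurable (by fun_prop)) 1
        (ae_of_all _ fun x => (hg0n x).le)
    exact (memLp_haarAddCircle_iff.mpr h.memLp_liftIoc).1
  let f : Lp ℂ 2 (haarAddCircle (T := (1:ℝ))) := fourierBasis.repr.symm ⟨a, ha⟩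
  have hf : ∀ n, fourierCoeff f n = a n := by
    intro n
    rw [← fourierBasis_repr]
    simp [f]
  have hgf : MemLp (fun x => g x * f x) 2 (haarAddCircle (T := (1:ℝ))) :=
    (Lp.memLp f).of_le (hgm.mul (Lp.memLp f).1) (ae_of_all _ fun x => by simp [hgn])
  have hx : ∀ m : ℤ, MemLp (fun x => fourier m x * (starRingEnd ℂ) (g x)) 2
      (haarAddCircle (T := (1:ℝ))) := by
    intro m
    refine MemLp.of_bound (((fourier m).continuous.aestronglyMeasurable).mul
      (Complex.continuous_conj.comp_aestronglyMeasurable hgm)) 1 (ae_of_all _ fun x => ?_)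
    rw [norm_mul, RCLike.norm_conj, hgn, mul_one, fourier_apply, Circle.norm_coe]
  have key : ∀ m : ℤ, fourierCoeff (hgf.toLp _) m = ((Real.sin (Real.pi * t) / Real.pi : ℝ) : ℂ) *
      ∑' n : ℤ, a n / ((m : ℂ) - (n : ℂ) + (t : ℂ)) := by
    intro m
    have h1 : fourierCoeff (hgf.toLp _) m = inner ℂ ((hx m).toLp _) f := by
      rw [fourierCoeff, MeasureTheory.L2.inner_def]
      refine integral_congr_ae ?_
      filter_upwards [hgf.coeFn_toLp, (hx m).coeFn_toLp] with x h1 h2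
      rw [h1, h2, RCLike.inner_apply']
      simp [mul_assoc]
    rw [h1, ← fourierBasis.tsum_inner_mul_inner, ← tsum_mul_left]
    refine tsum_congr fun n => ?_
    rw [← fourierBasis.repr_apply_apply f n, fourierBasis_repr, hf]
    have h2 : inner ℂ ((hx m).toLp _) (fourierBasis (T := (1:ℝ)) n) = fourierCoeff g (m - n) := by
      rw [fourierCoeff, MeasureTheory.L2.inner_def]
      refine integral_congr_ae ?_
      rw [coe_fourierBasis]
      filter_upwards [coeFn_fourierLp (T := (1:ℝ)) 2 n, (hx m).coeFn_toLp] with x h1 h2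
      rw [h1, h2, RCLike.inner_apply', neg_sub, sub_eq_add_neg, fourier_add]
      simp
      ring
    rw [h2, hg, hg0, aux_coeff t ht]
    push_cast
    ring
  simp_rw [← key]
  rw [tsum_sq_fourierCoeff]
  simp_rw [← hf]
  rw [tsum_sq_fourierCoeff]
  refine integral_congr_ae ?_
  filter_upwards [hgf.coeFn_toLp] with x h1
  rw [h1]
  simp [hgn]

/-- `T_t` is an isometry of `ℓ²(ℤ)`: `‖T_t a‖ = ‖a‖`. -/
theorem stmt_13 (t : ℝ) (a : ℤ → ℂ) (ha : Memℓp a 2) :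
    l2norm (fun m => Tgrp t a m) = l2norm a := by
  unfold l2norm
  congr 1
  by_cases h : t = (⌊t⌋ : ℝ)
  · simp only [Tgrp, if_pos h, norm_mul, norm_zpow, norm_neg, norm_one, one_zpow, one_mul]
    exact (Equiv.addRight ⌊t⌋).tsum_eq (fun m => ‖a m‖ ^ 2)
  · simp only [Tgrp, if_neg h]
    refine aux_main t (fun k hk => h ?_) a ha
    have : t = ((-k : ℤ) : ℝ) := by push_cast; linarith
    rw [this, Int.floor_intCast]
end

section
/- For every t₀ ∈ ℝ and every a ∈ ℓ²(ℤ), lim_{t→t₀} ‖T_t a − T_{t₀} a‖_{ℓ²} = 0; i.e., the family (T_t)_{t∈ℝ} is strongly continuous on ℓ²(ℤ). -/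
open Filter Topology

open MeasureTheory AddCircle in
/-- The multiplier on the unit circle corresponding to `T_t`. -/
noncomputable def gmul (t : ℝ) : AddCircle (1:ℝ) → ℂ :=
  AddCircle.liftIoc 1 0 (fun x : ℝ => Complex.exp (Complex.I * ((-(2 * Real.pi * t * (x - 1/2)) : ℝ) : ℂ)))

lemma gmul_meas (t : ℝ) : Measurable (gmul t) := by
  unfold gmul AddCircle.liftIoc
  have h1 : Measurable (fun x : ℝ => Complex.exp (Complex.I * ((-(2 * Real.pi * t * (x - 1/2)) : ℝ) : ℂ))) := by
    fun_prop
  exact (h1.comp measurable_subtype_coe).comp (AddCircle.measurableEquivIoc 1 0).measurable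

lemma gmul_norm (t : ℝ) (x : AddCircle (1:ℝ)) : ‖gmul t x‖ = 1 := by
  unfold gmul AddCircle.liftIoc
  simp only [Function.comp, Set.domRestrict_def]
  exact Complex.norm_exp_I_mul_ofReal _

lemma gmul_sub (t s : ℝ) (x : AddCircle (1:ℝ)) : ‖gmul t x - gmul s x‖ ≤ Real.pi * |t - s| := by
  unfold gmul AddCircle.liftIoc
  simp only [Function.comp, Set.domRestrict_def]
  obtain ⟨y, hy0, hy1⟩ := AddCircle.equivIoc (1:ℝ) 0 x
  simp only
  have : Complex.exp (Complex.I * ((-(2 * Real.pi * t * (y - 1/2)) : ℝ) : ℂ))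
      - Complex.exp (Complex.I * ((-(2 * Real.pi * s * (y - 1/2)) : ℝ) : ℂ))
      = Complex.exp (Complex.I * ((-(2 * Real.pi * s * (y - 1/2)) : ℝ) : ℂ)) *
        (Complex.exp (Complex.I * ((-(2 * Real.pi * (t - s) * (y - 1/2)) : ℝ) : ℂ)) - 1) := by
    rw [mul_sub (Complex.exp _), ← Complex.exp_add, mul_one]
    congr 2
    push_cast
    ring
  rw [this, norm_mul, Complex.norm_exp_I_mul_ofReal, one_mul]
  refine (Real.norm_exp_I_mul_ofReal_sub_one_le).trans ?_
  rw [Real.norm_eq_abs, abs_neg, abs_mul, abs_mul, abs_of_pos (by positivity : 0 < 2 * Real.pi)]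
  have : |y - 1/2| ≤ 1/2 := by rw [abs_le]; constructor <;> linarith
  have h2 : 0 ≤ 2 * Real.pi * |t - s| := by positivity
  nlinarith

open MeasureTheory AddCircle in
lemma gmul_int (t : ℝ) (m n : ℤ) :
    ∫ x : AddCircle (1:ℝ), fourier (-m) x * (gmul t x * fourier n x) ∂haarAddCircle
      = Complex.exp (Real.pi * Complex.I * t) *
        ∫ x in (0:ℝ)..1, Complex.exp ((-(2 * Real.pi * Complex.I * (m - n + t))) * x) := by
  rw [AddCircle.integral_haarAddCircle, ← AddCircle.intervalIntegral_preimage 1 0, inv_one, one_smul,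
    ← intervalIntegral.integral_const_mul, zero_add]
  apply intervalIntegral.integral_congr_ae
  refine .of_forall fun x hx ↦ ?_
  rw [Set.uIoc_of_le (by norm_num)] at hx
  rw [gmul, AddCircle.liftIoc_coe_apply (by simpa using hx), fourier_coe_apply, fourier_coe_apply,
    ← Complex.exp_add, ← Complex.exp_add, ← Complex.exp_add]
  congr 1
  push_cast
  ring

lemma kern_zero : (∫ x in (0:ℝ)..1, Complex.exp ((-(2 * Real.pi * Complex.I * 0)) * x)) = 1 := by
  simp

lemma kern_ne (t : ℝ) (k : ℤ) (h : (k : ℂ) + t ≠ 0) :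
    Complex.exp (Real.pi * Complex.I * t) *
      (∫ x in (0:ℝ)..1, Complex.exp ((-(2 * Real.pi * Complex.I * (k + t))) * x))
      = ((Real.sin (Real.pi * t) / Real.pi : ℝ) : ℂ) / (k + t) := by
  have hpi : (Real.pi : ℂ) ≠ 0 := by exact_mod_cast Real.pi_ne_zero
  rw [integral_exp_mul_complex (by
    simp only [neg_ne_zero]
    exact mul_ne_zero (mul_ne_zero (mul_ne_zero two_ne_zero hpi) Complex.I_ne_zero) h)]
  have e1 : Complex.exp ((-(2 * Real.pi * Complex.I * (k + t))) * (1:ℝ))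
      = Complex.exp (-(Real.pi * Complex.I * t)) * Complex.exp (-(Real.pi * Complex.I * t)) := by
    rw [← Complex.exp_add, ← Complex.exp_periodic.int_mul k]
    congr 1
    push_cast
    ring
  have e2 : Complex.exp (Real.pi * Complex.I * t) * Complex.exp (-(Real.pi * Complex.I * t)) = 1 := by
    rw [← Complex.exp_add]; simp
  rw [e1]
  push_cast
  rw [Complex.sin]
  have e3 : -(↑Real.pi * ↑t) * Complex.I = -(Real.pi * Complex.I * t) := by ring
  have e4 : (↑Real.pi * ↑t) * Complex.I = (Real.pi * Complex.I * t) := by ring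
  rw [e3, e4]
  generalize Complex.exp (Real.pi * Complex.I * t) = A at *
  generalize Complex.exp (-(Real.pi * Complex.I * t)) = B at *
  simp only [mul_zero, Complex.exp_zero]
  have hI : Complex.I ≠ 0 := Complex.I_ne_zero
  rw [← mul_div_assoc, div_div, div_eq_div_iff]
  · have : A * (B * B - 1) = B - A := by
      rw [mul_sub, ← mul_assoc, e2]; ring
    rw [this]
    linear_combination ((B - A) * Real.pi * (k + t)) * Complex.I_mul_I
  · simp only [neg_ne_zero]
    exact mul_ne_zero (mul_ne_zero (mul_ne_zero two_ne_zero hpi) Complex.I_ne_zero) h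
  · exact mul_ne_zero hpi h

open MeasureTheory AddCircle in
lemma hasSum_gmul (t : ℝ) (F : Lp ℂ 2 (@haarAddCircle 1 _)) (m : ℤ) :
    HasSum (fun n : ℤ => fourierCoeff F n *
      ∫ x : AddCircle (1:ℝ), fourier (-m) x * (gmul t x * fourier n x) ∂haarAddCircle)
      (∫ x : AddCircle (1:ℝ), fourier (-m) x * (gmul t x * F x) ∂haarAddCircle) := by
  have hmeas : Measurable (fun x : AddCircle (1:ℝ) => (starRingEnd ℂ) (gmul t x) * fourier m x) := by
    have := gmul_meas t
    have h2 : Measurable (fun x : AddCircle (1:ℝ) => (fourier m x : ℂ)) :=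
      (map_continuous (fourier m)).measurable
    exact (Complex.continuous_conj.measurable.comp this).mul h2
  have hmem : MemLp (fun x : AddCircle (1:ℝ) => (starRingEnd ℂ) (gmul t x) * fourier m x) 2
      haarAddCircle := by
    refine MemLp.of_bound hmeas.aestronglyMeasurable 1 (.of_forall fun x => ?_)
    rw [norm_mul, RCLike.norm_conj, gmul_norm, fourier_apply, Circle.norm_coe, one_mul]
  have key : ∀ G : Lp ℂ 2 (@haarAddCircle 1 _), inner ℂ hmem.toLp G =
      ∫ x : AddCircle (1:ℝ), fourier (-m) x * (gmul t x * G x) ∂haarAddCircle := by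
    intro G
    rw [MeasureTheory.L2.inner_def]
    apply integral_congr_ae
    filter_upwards [hmem.coeFn_toLp] with x hx
    rw [hx, RCLike.inner_apply', map_mul, fourier_neg, Complex.conj_conj]
    ring
  have h := (hasSum_fourier_series_L2 F).mapL (innerSL ℂ hmem.toLp)
  simp only [innerSL_apply_apply, inner_smul_right] at h
  rw [key F] at h
  suffices e : ∀ n : ℤ, fourierCoeff F n *
      ∫ x : AddCircle (1:ℝ), fourier (-m) x * (gmul t x * fourier n x) ∂haarAddCircle
      = inner ℂ hmem.toLp (fourierCoeff F n • fourierLp 2 n) by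
    simpa only [e, inner_smul_right] using h
  intro n
  rw [inner_smul_right, key]
  congr 1
  apply integral_congr_ae
  filter_upwards [coeFn_fourierLp 2 n] with x hx
  rw [hx]

open MeasureTheory AddCircle in
lemma Tgrp_eq (t : ℝ) (a : ℤ → ℂ) (F : Lp ℂ 2 (@haarAddCircle 1 _))
    (hF : ∀ n, fourierCoeff F n = a n) (m : ℤ) :
    ∫ x : AddCircle (1:ℝ), fourier (-m) x * (gmul t x * F x) ∂haarAddCircle = Tgrp t a m := by
  have h := hasSum_gmul t F m
  simp only [hF, gmul_int] at h
  have key : ∀ n : ℤ, ((m - n : ℤ) : ℂ) + t ≠ 0 → Complex.exp (Real.pi * Complex.I * t) *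
        (∫ x in (0:ℝ)..1, Complex.exp ((-(2 * Real.pi * Complex.I * (m - n + t))) * x)) =
        ((Real.sin (Real.pi * t) / Real.pi : ℝ) : ℂ) / (m - n + t) := by
    intro n hn
    have := kern_ne t (m - n) hn
    push_cast at this ⊢
    exact this
  unfold Tgrp
  split_ifs with ht
  · generalize ⌊t⌋ = k at ht
    subst ht
    have hs : Real.sin (Real.pi * k) = 0 := by rw [mul_comm]; exact Real.sin_int_mul_pi k
    refine h.unique ?_
    convert hasSum_single (m + k) ?_ using 1
    · push_cast
      rw [show (m : ℂ) - (m + k) + k = 0 by ring, kern_zero, mul_one, mul_comm]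
      congr 1
      rw [show (Real.pi : ℂ) * Complex.I * k = k * (Real.pi * Complex.I) by ring, Complex.exp_int_mul,
        Complex.exp_pi_mul_I]
    · intro n hn
      rw [key n, hs]
      · simp
      · intro h0
        apply hn
        have : (m - n + k : ℤ) = 0 := by exact_mod_cast h0
        omega
  · rw [← h.tsum_eq, ← tsum_mul_left]
    congr 1
    ext n
    rw [key n]
    · ring
    · intro h0
      apply ht
      have h1 : ((m - n : ℤ) : ℝ) + t = 0 := by exact_mod_cast h0
      have h2 : t = ((n - m : ℤ) : ℝ) := by push_cast at h1 ⊢; linarith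
      rw [h2, Int.floor_intCast]

open MeasureTheory AddCircle in
lemma l2_bound (t s : ℝ) (a : ℤ → ℂ) (F : Lp ℂ 2 (@haarAddCircle 1 _))
    (hF : ∀ n, fourierCoeff F n = a n) :
    l2norm (fun m => Tgrp t a m - Tgrp s a m) ≤
      Real.pi * |t - s| * Real.sqrt (∫ x, ‖F x‖ ^ 2 ∂haarAddCircle) := by
  have hFm : MemLp F 2 (@haarAddCircle 1 _) := Lp.memLp F
  have hm : ∀ r, MemLp (fun x => gmul r x * F x) 2 (@haarAddCircle 1 _) := fun r => by
    refine hFm.of_le_mul (c := 1) ((gmul_meas r).aestronglyMeasurable.mul hFm.1)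
      (.of_forall fun x => ?_)
    rw [norm_mul, gmul_norm]
  have hG := (hm t).sub (hm s)
  have hi : ∀ r, Integrable (fun x => gmul r x * F x) (@haarAddCircle 1 _) := fun r =>
    (hm r).integrable (by norm_num)
  have hc : ∀ m, fourierCoeff (hG.toLp) m = Tgrp t a m - Tgrp s a m := by
    intro m
    rw [fourierCoeff_congr_ae hG.coeFn_toLp, ← Tgrp_eq t a F hF, ← Tgrp_eq s a F hF, fourierCoeff]
    refine Eq.trans ?_ (integral_sub ((hi t).fourier_smul (-m)) ((hi s).fourier_smul (-m)))
    congr 1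
    ext x
    simp only [Pi.sub_apply, smul_eq_mul]
    ring
  unfold l2norm
  simp only [← hc]
  rw [tsum_sq_fourierCoeff]
  apply Real.sqrt_le_iff.2
  refine ⟨by positivity, ?_⟩
  rw [mul_pow, Real.sq_sqrt (integral_nonneg fun x => by positivity), ← integral_const_mul]
  apply integral_mono_ae
  · exact (memLp_two_iff_integrable_sq_norm (Lp.memLp _).1).1 (Lp.memLp _)
  · exact ((memLp_two_iff_integrable_sq_norm hFm.1).1 hFm).const_mul _
  · filter_upwards [hG.coeFn_toLp] with x hx
    rw [hx, ← mul_pow]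
    simp only [Pi.sub_apply]
    rw [← sub_mul, norm_mul]
    gcongr
    exact gmul_sub t s x

/-- Strong continuity: for every `t₀ ∈ ℝ` and `a ∈ ℓ²(ℤ)`,
`‖T_t a − T_{t₀} a‖_{ℓ²} → 0` as `t → t₀`. -/
theorem stmt_14 (t₀ : ℝ) (a : ℤ → ℂ) (ha : Memℓp a 2) :
    Tendsto (fun t : ℝ => l2norm (fun m => Tgrp t a m - Tgrp t₀ a m))
      (𝓝 t₀) (𝓝 0) := by
  let F := (fourierBasis (T := (1:ℝ))).repr.symm ⟨a, ha⟩
  have hF : ∀ n, fourierCoeff F n = a n := by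
    intro n
    rw [← fourierBasis_repr]
    simp [F]
  refine squeeze_zero (fun t => Real.sqrt_nonneg _) (fun t => l2_bound t t₀ a F hF) ?_
  have hc : Continuous (fun t : ℝ => Real.pi * |t - t₀| *
      Real.sqrt (∫ x, ‖F x‖ ^ 2 ∂AddCircle.haarAddCircle)) := by fun_prop
  have := hc.tendsto t₀
  simpa using this
end

section
/- For every a ∈ ℓ²(ℤ), lim_{d→0} ‖(T_d a − a)/d − π·H a‖_{ℓ²} = 0; i.e., π·H is the infinitesimal generator of the group (T_t), where (H a)_m = (1/π)·Σ_{n≠m} a_n/(m−n). -/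
/-- The discrete Hilbert transform `(H a)_m = (1/π)·∑_{n≠m} a_n/(m−n)`. -/
noncomputable def Hop (a : ℤ → ℂ) (m : ℤ) : ℂ :=
  (1 / (Real.pi : ℂ)) * ∑' n : {n : ℤ // n ≠ m}, a n.1 / ((m : ℂ) - (n.1 : ℂ))

open Filter Topology


section aux
open MeasureTheory AddCircle Complex

local instance factOne : Fact ((0:ℝ) < 1) := ⟨one_pos⟩

/-- fractional-part coordinate on the circle -/
noncomputable def Xc (x : AddCircle (1:ℝ)) : ℝ := (AddCircle.equivIco (1:ℝ) 0 x : ℝ)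

lemma Xc_mem (x : AddCircle (1:ℝ)) : 0 ≤ Xc x ∧ Xc x < 1 := by
  have := (AddCircle.equivIco (1:ℝ) 0 x).2
  simpa [Xc] using this

lemma Xc_coe {x : ℝ} (h0 : 0 ≤ x) (h1 : x < 1) : Xc (x : AddCircle (1:ℝ)) = x :=
  AddCircle.equivIco_coe_of_mem (p := (1:ℝ)) (a := 0) (by simp [h0, h1])

lemma measurable_Xc : Measurable Xc :=
  measurable_subtype_coe.comp (AddCircle.measurableEquivIco (1:ℝ) 0).measurable

lemma coeff_eq (φ : ℝ → ℂ) (n : ℤ) :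
    fourierCoeff (T := (1:ℝ)) (fun x => φ (Xc x)) n
      = ∫ x in (0:ℝ)..1, Complex.exp (-(2 * Real.pi * I * n) * x) * φ x := by
  rw [fourierCoeff_eq_intervalIntegral _ _ 0]
  simp only [zero_add, one_div, inv_one, one_smul]
  refine intervalIntegral.integral_congr_Ioo_of_le zero_le_one fun x hx => ?_
  simp only [Xc_coe hx.1.le hx.2, fourier_coe_apply, smul_eq_mul]
  congr 2
  push_cast
  ring

lemma coeff_g (n : ℤ) :
    fourierCoeff (T := (1:ℝ)) (fun x => 2 * Real.pi * I * (1 / 2 - (Xc x : ℂ))) n = 1 / (n : ℂ) := by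
  rw [coeff_eq (fun x => 2 * Real.pi * I * (1 / 2 - (x : ℂ)))]
  have h := bernoulliFourierCoeff_eq one_ne_zero n
  rw [bernoulliFourierCoeff, fourierCoeffOn_eq_integral] at h
  have h2 : ∫ x in (0:ℝ)..1, Complex.exp (-(2 * Real.pi * I * n) * x) *
      (2 * Real.pi * I * (1 / 2 - (x : ℂ))) = (-(2 * Real.pi * I)) *
      ((1 / ((1:ℝ) - 0)) • ∫ x in (0:ℝ)..1,
        fourier (-n) (x : AddCircle ((1:ℝ) - 0)) • ((bernoulliFun 1 x : ℝ) : ℂ)) := by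
    simp only [sub_zero, one_div, inv_one, one_smul]
    rw [← intervalIntegral.integral_const_mul]
    congr 1
    ext x
    rw [bernoulliFun_one, fourier_coe_apply, smul_eq_mul]
    push_cast
    rw [show 2 * (Real.pi : ℂ) * I * -(n:ℂ) * x / (1 - 0) = -(2 * Real.pi * I * n) * x by ring]
    ring
  rw [h2, h]
  have : (2 * (Real.pi : ℂ) * I) ≠ 0 := by simp [Real.pi_ne_zero]
  rcases eq_or_ne n 0 with rfl | hn
  · simp
  have hn' : (n : ℂ) ≠ 0 := by exact_mod_cast hn
  simp
  field_simp

lemma coeff_e (d : ℝ) (n : ℤ) (hd : (n : ℂ) + d ≠ 0) :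
    fourierCoeff (T := (1:ℝ)) (fun x => Complex.exp (d * (2 * Real.pi * I * (1 / 2 - (Xc x : ℂ))))) n
      = ((Real.sin (Real.pi * d) / Real.pi : ℝ) : ℂ) * (1 / ((n : ℂ) + d)) := by
  rw [coeff_eq (fun x => Complex.exp (d * (2 * Real.pi * I * (1 / 2 - (x : ℂ)))))]
  have hpi : (Real.pi : ℂ) ≠ 0 := by simp [Real.pi_ne_zero]
  have hc : -(2 * Real.pi * I * ((n : ℂ) + d)) ≠ 0 := by simp [Real.pi_ne_zero, hd]
  have : ∀ x : ℝ, Complex.exp (-(2 * Real.pi * I * n) * x) *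
      Complex.exp (d * (2 * Real.pi * I * (1 / 2 - (x : ℂ)))) =
      Complex.exp (Real.pi * d * I) * Complex.exp (-(2 * Real.pi * I * ((n : ℂ) + d)) * x) := by
    intro x
    rw [← Complex.exp_add, ← Complex.exp_add]
    congr 1
    ring
  simp_rw [this]
  rw [intervalIntegral.integral_const_mul, integral_exp_mul_complex hc]
  have e1 : Complex.exp (-(2 * Real.pi * I * ((n : ℂ) + d)) * (1:ℝ)) =
      Complex.exp (-(Real.pi * d * I)) * Complex.exp (-(Real.pi * d * I)) := by
    have := Complex.exp_int_mul_two_pi_mul_I (-n)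
    rw [← Complex.exp_add, ← mul_one (Complex.exp (_ + _)), ← this, ← Complex.exp_add]
    congr 1
    push_cast
    ring
  have e2 : Complex.exp (Real.pi * d * I) * Complex.exp (-(Real.pi * d * I)) = 1 := by
    rw [← Complex.exp_add]; simp
  rw [e1]
  push_cast
  rw [Complex.sin]
  rw [show -(Real.pi * (d:ℂ)) * I = -(Real.pi * d * I) by ring]
  simp only [mul_zero, Complex.exp_zero]
  generalize Complex.exp (Real.pi * d * I) = u at *
  generalize Complex.exp (-(Real.pi * d * I)) = v at *
  have e3 : u * (v * v - 1) = v - u := by linear_combination v * e2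
  rw [mul_div_assoc', e3]
  have : I ≠ 0 := I_ne_zero
  field_simp
  rw [I_sq]
  ring

lemma mult_lemma (f : Lp ℂ 2 (@haarAddCircle (1:ℝ) _)) (ψ : AddCircle (1:ℝ) → ℂ)
    (hψ : Measurable ψ) (M : ℝ) (hM : ∀ x, ‖ψ x‖ ≤ M) :
    (∀ m : ℤ, HasSum (fun n : ℤ => fourierCoeff ψ (m - n) * fourierCoeff f n)
      (fourierCoeff (fun x => ψ x * f x) m)) ∧
    ∑' m : ℤ, ‖fourierCoeff (fun x => ψ x * f x) m‖ ^ 2 ≤ M ^ 2 * ‖f‖ ^ 2 := by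
  constructor
  · intro m
    have hG : MemLp (fun x => (starRingEnd ℂ) (ψ x) * fourier m x) 2 (@haarAddCircle (1:ℝ) _) := by
      refine MemLp.of_bound (C := M) ?_ (ae_of_all _ fun x => ?_)
      · exact ((Complex.continuous_conj.measurable.comp hψ).mul
          (fourier m).continuous.measurable).aestronglyMeasurable
      · rw [norm_mul, fourier_apply, Circle.norm_coe]; simpa using hM x
    have h := (fourierBasis (T := (1:ℝ))).hasSum_inner_mul_inner hG.toLp f
    have h1 : inner ℂ hG.toLp f = fourierCoeff (fun x => ψ x * f x) m := by
      rw [MeasureTheory.L2.inner_def, fourierCoeff]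
      apply integral_congr_ae
      filter_upwards [hG.coeFn_toLp] with x hx
      rw [hx, RCLike.inner_apply', map_mul, fourier_neg, smul_eq_mul, Complex.conj_conj]
      ring
    have h2 : ∀ n, inner ℂ hG.toLp (fourierBasis (T := (1:ℝ)) n) = fourierCoeff ψ (m - n) := by
      intro n
      rw [MeasureTheory.L2.inner_def, fourierCoeff]
      apply integral_congr_ae
      rw [coe_fourierBasis]
      filter_upwards [hG.coeFn_toLp, coeFn_fourierLp 2 n] with x hx hx2
      rw [hx, hx2, RCLike.inner_apply', map_mul, Complex.conj_conj, neg_sub, sub_eq_add_neg,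
        fourier_add, fourier_neg, smul_eq_mul]
      ring
    rw [h1] at h
    simp_rw [h2, ← HilbertBasis.repr_apply_apply, fourierBasis_repr] at h
    exact h
  · have hL : MemLp (fun x => ψ x * f x) 2 (@haarAddCircle (1:ℝ) _) := by
      refine MemLp.of_le_mul (c := M) (Lp.memLp f)
        (hψ.aestronglyMeasurable.mul (Lp.aestronglyMeasurable f)) (ae_of_all _ fun x => ?_)
      rw [norm_mul]
      exact mul_le_mul_of_nonneg_right (hM x) (norm_nonneg _)
    have hM0 : 0 ≤ M := (norm_nonneg _).trans (hM 0)
    rw [← fourierCoeff_congr_ae hL.coeFn_toLp]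
    have h3 : ∀ F : Lp ℂ 2 (@haarAddCircle (1:ℝ) _), ∑' m : ℤ, ‖fourierCoeff F m‖ ^ 2 = ‖F‖ ^ 2 := by
      intro F
      simp_rw [← fourierBasis_repr]
      have H₁ : HasSum (fun i => ‖fourierBasis.repr F i‖ ^ 2) (‖fourierBasis.repr F‖ ^ 2) := by
        apply_mod_cast lp.hasSum_norm ?_ (fourierBasis.repr F)
        simp
      rw [H₁.tsum_eq]
      simp
    rw [h3, ← mul_pow]
    gcongr
    refine Lp.norm_le_mul_norm_of_ae_le_mul ?_
    filter_upwards [hL.coeFn_toLp] with x hx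
    rw [hx, norm_mul]
    exact mul_le_mul_of_nonneg_right (hM x) (norm_nonneg _)

lemma key (a : ℤ → ℂ) (ha : Memℓp a 2) : ∃ C : ℝ, 0 ≤ C ∧ ∀ d : ℝ, d ≠ 0 → |d| < 1 / 4 →
    l2norm (fun m => (Tgrp d a m - a m) / (d : ℂ) - (Real.pi : ℂ) * Hop a m) ≤ C * |d| := by
  obtain ⟨f, hf⟩ : ∃ f : Lp ℂ 2 (@haarAddCircle (1:ℝ) _), ∀ n, fourierCoeff f n = a n := by
    refine ⟨fourierBasis.repr.symm ⟨a, ha⟩, fun n => ?_⟩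
    rw [← fourierBasis_repr]
    simp
  refine ⟨Real.pi ^ 2 * ‖f‖, by positivity, fun d hd0 hd => ?_⟩
  have hd1 := abs_lt.1 hd
  have hdC : (d : ℂ) ≠ 0 := by exact_mod_cast hd0
  set g : AddCircle (1:ℝ) → ℂ := fun x => 2 * Real.pi * I * (1 / 2 - (Xc x : ℂ)) with hg
  set e : AddCircle (1:ℝ) → ℂ := fun x => Complex.exp (d * g x) with he
  have mX : Measurable (fun x => (Xc x : ℂ)) := Complex.measurable_ofReal.comp measurable_Xc
  have mg : Measurable g := (measurable_const.sub mX).const_mul _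
  have me : Measurable e := Complex.measurable_exp.comp (mg.const_mul _)
  have hgI : ∀ x, g x = ((2 * Real.pi * (1 / 2 - Xc x) : ℝ) : ℂ) * I := by
    intro x; simp only [hg]; push_cast; ring
  have bg : ∀ x, ‖g x‖ ≤ Real.pi := by
    intro x
    rw [hgI, norm_mul, norm_I, mul_one, Complex.norm_real, Real.norm_eq_abs, abs_le]
    have := Xc_mem x
    constructor <;> nlinarith [Real.pi_pos]
  have be : ∀ x, ‖e x‖ ≤ 1 := by
    intro x
    simp only [he]
    rw [hgI, ← mul_assoc, ← Complex.ofReal_mul, Complex.norm_exp_ofReal_mul_I]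
  have hne : ∀ n : ℤ, (n : ℂ) + d ≠ 0 := by
    intro n hn
    have h1 : (n : ℝ) + d = 0 := by exact_mod_cast hn
    rcases lt_trichotomy n 0 with h | h | h
    · have : (n : ℝ) ≤ -1 := by exact_mod_cast Int.le_sub_one_of_lt h
      linarith
    · subst h; simp at h1; exact hd0 h1
    · have : (1 : ℝ) ≤ n := by exact_mod_cast h
      linarith
  obtain ⟨Hg, -⟩ := mult_lemma f g mg _ bg
  obtain ⟨He, -⟩ := mult_lemma f e me _ be
  have be2 : ∀ x, ‖(e x - 1) / d - g x‖ ≤ Real.pi ^ 2 * |d| := by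
    intro x
    have h1 : ‖(d : ℂ) * g x‖ ≤ |d| * Real.pi := by
      rw [norm_mul, Complex.norm_real, Real.norm_eq_abs]
      exact mul_le_mul_of_nonneg_left (bg x) (abs_nonneg _)
    have h2 : ‖(d : ℂ) * g x‖ ≤ 1 := by nlinarith [Real.pi_lt_four, Real.pi_pos, abs_nonneg d]
    have h3 := Complex.norm_exp_sub_one_sub_id_le h2
    have h4 : (e x - 1) / d - g x = (Complex.exp (d * g x) - 1 - d * g x) / d := by
      simp only [he]; field_simp
    have hdp : 0 < |d| := abs_pos.2 hd0
    rw [h4, norm_div, Complex.norm_real, Real.norm_eq_abs, div_le_iff₀ hdp]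
    calc _ ≤ ‖(d : ℂ) * g x‖ ^ 2 := h3
      _ ≤ (|d| * Real.pi) ^ 2 := by gcongr
      _ = _ := by ring
  obtain ⟨-, Hb⟩ := mult_lemma f (fun x => (e x - 1) / d - g x)
    (((me.sub measurable_const).div_const _).sub mg) _ be2
  have hT : ∀ m, Tgrp d a m = fourierCoeff (fun x => e x * f x) m := by
    intro m
    have hfl : ¬ (d = (⌊d⌋ : ℝ)) := by
      intro h
      apply hne (-⌊d⌋)
      rw [h]; push_cast; simp
    rw [Tgrp, if_neg hfl, ← tsum_mul_left, ← (He m).tsum_eq]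
    congr 1
    ext n
    rw [coeff_e d _ (hne _), hf]
    push_cast
    ring
  have hH : ∀ m, (Real.pi : ℂ) * Hop a m = fourierCoeff (fun x => g x * f x) m := by
    intro m
    have hpi : (Real.pi : ℂ) ≠ 0 := by simp [Real.pi_ne_zero]
    rw [Hop, ← mul_assoc, mul_one_div_cancel hpi, one_mul, ← (Hg m).tsum_eq]
    have : ∀ n : ℤ, fourierCoeff g (m - n) * fourierCoeff f n = a n / ((m : ℂ) - n) := by
      intro n
      rw [coeff_g, hf]; push_cast; ring
    simp_rw [this]
    refine tsum_subtype_eq_of_support_subset (s := {n : ℤ | n ≠ m})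
      (f := fun n : ℤ => a n / ((m : ℂ) - n)) ?_
    intro n hn hnm
    apply hn
    simp [hnm]
  have fi : Integrable f (@haarAddCircle (1:ℝ) _) := (Lp.memLp f).integrable (by norm_num)
  have hlin : ∀ m, (Tgrp d a m - a m) / (d : ℂ) - (Real.pi : ℂ) * Hop a m =
      fourierCoeff (fun x => ((e x - 1) / d - g x) * f x) m := by
    intro m
    rw [hT, hH, ← hf m]
    have ie : Integrable (fun x => e x * f x) (@haarAddCircle (1:ℝ) _) :=
      fi.bdd_mul me.aestronglyMeasurable (ae_of_all _ be)
    have ig : Integrable (fun x => g x * f x) (@haarAddCircle (1:ℝ) _) :=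
      fi.bdd_mul mg.aestronglyMeasurable (ae_of_all _ bg)
    simp only [fourierCoeff]
    rw [← integral_sub (ie.fourier_smul _) (fi.fourier_smul _), ← integral_div]
    have i1 : Integrable (fun x => ((fourier (-m)) x • (e x * f x) - (fourier (-m)) x • f x) / (d : ℂ))
        (@haarAddCircle (1:ℝ) _) :=
      ((ie.fourier_smul (-m)).sub (fi.fourier_smul (-m))).div_const _
    rw [← integral_sub i1 (ig.fourier_smul _)]
    congr 1
    ext x
    simp only [smul_eq_mul]
    ring
  simp_rw [hlin]
  rw [l2norm]
  refine Real.sqrt_le_iff.2 ⟨by positivity, Hb.trans (le_of_eq (by ring))⟩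

end aux

/-- `π·H` is the infinitesimal generator of `(T_t)`:
`‖(T_d a − a)/d − π·H a‖_{ℓ²} → 0` as `d → 0`. -/
theorem stmt_15 (a : ℤ → ℂ) (ha : Memℓp a 2) :
    Tendsto (fun d : ℝ =>
        l2norm (fun m => (Tgrp d a m - a m) / (d : ℂ) - (Real.pi : ℂ) * Hop a m))
      (𝓝[≠] (0 : ℝ)) (𝓝 0) := by
  obtain ⟨C, hC, h⟩ := key a ha
  have h0 : Tendsto (fun d : ℝ => C * |d|) (𝓝[≠] (0 : ℝ)) (𝓝 0) := by
    have : Tendsto (fun d : ℝ => C * |d|) (𝓝 (0 : ℝ)) (𝓝 (C * |0|)) :=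
      (continuous_const.mul continuous_abs).tendsto 0
    simp only [abs_zero, mul_zero] at this
    exact this.mono_left nhdsWithin_le_nhds
  refine squeeze_zero' (Eventually.of_forall fun d => Real.sqrt_nonneg _) ?_ h0
  have h1 : ∀ᶠ d : ℝ in 𝓝[≠] (0 : ℝ), |d| < 1 / 4 := by
    apply eventually_nhdsWithin_of_eventually_nhds
    have : Tendsto (fun d : ℝ => |d|) (𝓝 0) (𝓝 |0|) := continuous_abs.tendsto 0
    rw [abs_zero] at this
    exact this.eventually (gt_mem_nhds (by norm_num))
  filter_upwards [h1, self_mem_nhdsWithin] with d hd hd0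
  exact h d hd0 hd
end
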